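/- arXiv:2404.12828 — 3 statements merged into one kernel-verified Lean document; each statement's English description precedes it below -/
import Mathlib

section
/- Suppose f is (𝒞, δ)-regular for some δ < 1/3, and suppose there is a minimizer x* of x ↦ f(x) + h(x) over all of ℝ^d such that x* ∈ 𝒞. Then, with stepsize η = 1/(1+δ), any sequence (x_t) with x₀ ∈ 𝒞 and x_{t+1} ∈ argmin_{z ∈ 𝒞} [⟨∇f(x_t), z⟩ + (1/(2η))‖x_t − z‖² + h(z)] satisfies ‖x_{t+1} − x*‖² ≤ (2δ/(1−δ))‖x_t − x*‖² for all t ≥ 0. -/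
open scoped RealInnerProductSpace

/-- First-order optimality for a composite objective: at a global minimizer `s` of `f + h`, with `f`
differentiable at `s` and `h` convex, the negative gradient of `f` is a subgradient of `h`. -/
theorem ConvexOn.neg_inner_gradient_le_sub_of_forall_add_le {E : Type*} [NormedAddCommGroup E]
    [InnerProductSpace ℝ E] [CompleteSpace E] {f h : E → ℝ} {g s : E}
    (hconv : ConvexOn ℝ Set.univ h) (hf : HasGradientAt f g s)
    (hmin : ∀ x, f s + h s ≤ f x + h x) (y : E) :
    -⟪g, y - s⟫ ≤ h y - h s := by
  have hd : HasDerivAt (fun t : ℝ => f (s + t • (y - s))) ⟪g, y - s⟫ 0 := by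
    have hline : HasDerivAt (fun t : ℝ => s + t • (y - s)) (y - s) 0 := by
      simpa using ((hasDerivAt_id (0 : ℝ)).smul_const (y - s)).const_add s
    have hfd : HasFDerivAt f (InnerProductSpace.toDual ℝ E g) (s + (0 : ℝ) • (y - s)) := by
      simpa using hf.hasFDerivAt
    simpa [Function.comp_def] using hfd.comp_hasDerivAt (0 : ℝ) hline
  have hlim := hd.tendsto_slope_zero_right
  suffices h s - h y ≤ ⟪g, y - s⟫ by linarith
  refine ge_of_tendsto hlim ?_
  filter_upwards [Ioo_mem_nhdsGT (zero_lt_one' ℝ)] with t ht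
  have hc := hconv.2 (Set.mem_univ s) (Set.mem_univ y) (sub_nonneg.2 ht.2.le) ht.1.le
    (sub_add_cancel 1 t)
  have hp : (1 - t) • s + t • y = s + t • (y - s) := by module
  rw [hp] at hc
  have hm := hmin (s + t • (y - s))
  simp only [smul_eq_mul, zero_add, zero_smul, add_zero] at hc ⊢
  rw [inv_mul_eq_div, le_div_iff₀ ht.1]
  linarith

/-- **Lemma 4 (convergence of constrained proximal gradient descent).**
If `f` is `(𝒞, δ)`-regular with `δ < 1/3` and the unconstrained minimizer
`x*` of `f + h` lies in `𝒞`, then with stepsize `η = 1/(1+δ)` the constrained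
proximal gradient iterates contract linearly towards `x*`. -/
theorem constrained_prox_grad_linear_convergence {d : ℕ}
    (C : Set (EuclideanSpace ℝ (Fin d))) (hC : IsClosed C)
    (f : EuclideanSpace ℝ (Fin d) → ℝ)
    (f' : EuclideanSpace ℝ (Fin d) → EuclideanSpace ℝ (Fin d))
    (hf : ∀ x, HasGradientAt f (f' x) x)
    (h : EuclideanSpace ℝ (Fin d) → ℝ)
    (hconv : ConvexOn ℝ Set.univ h) (hbdd : BddBelow (Set.range h))
    (δ : ℝ) (hδ : δ < 1 / 3)
    (hreg : ∀ x ∈ C, ∀ y ∈ C,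
      |f y - f x - ⟪f' x, y - x⟫ - 1 / 2 * ‖y - x‖ ^ 2| ≤ δ / 2 * ‖y - x‖ ^ 2)
    (xstar : EuclideanSpace ℝ (Fin d)) (hxstarC : xstar ∈ C)
    (hxstar : ∀ x, f xstar + h xstar ≤ f x + h x)
    (η : ℝ) (hη : η = 1 / (1 + δ))
    (x : ℕ → EuclideanSpace ℝ (Fin d)) (hx0 : x 0 ∈ C)
    (hstep : ∀ t, x (t + 1) ∈ C ∧ ∀ z ∈ C,
      ⟪f' (x t), x (t + 1)⟫ + 1 / (2 * η) * ‖x t - x (t + 1)‖ ^ 2 + h (x (t + 1)) ≤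
        ⟪f' (x t), z⟫ + 1 / (2 * η) * ‖x t - z‖ ^ 2 + h z) :
    ∀ t, ‖x (t + 1) - xstar‖ ^ 2 ≤ 2 * δ / (1 - δ) * ‖x t - xstar‖ ^ 2 := by
  have hxC : ∀ t, x t ∈ C
    | 0 => hx0
    | t + 1 => (hstep t).1
  intro t
  rcases lt_or_ge δ 0 with hneg | hnonneg
  · have heq : ∀ y ∈ C, y = xstar := by
      intro y hy
      have hr := (abs_nonneg _).trans (hreg xstar hxstarC y hy)
      by_contra hne
      have hpos : 0 < ‖y - xstar‖ ^ 2 := pow_pos (norm_pos_iff.2 (sub_ne_zero.2 hne)) 2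
      nlinarith
    simp [heq _ (hxC t), heq _ (hxC (t + 1))]
  · have hlow := (abs_le.1 (hreg xstar hxstarC (x (t + 1)) (hxC _))).1
    have hup := (abs_le.1 (hreg (x t) (hxC t) (x (t + 1)) (hxC _))).2
    have hlow' := (abs_le.1 (hreg (x t) (hxC t) xstar hxstarC)).1
    have hopt := hconv.neg_inner_gradient_le_sub_of_forall_add_le (hf xstar) hxstar (x (t + 1))
    have hprox := (hstep t).2 xstar hxstarC
    have hcoef : 1 / (2 * η) = (1 + δ) / 2 := by rw [hη]; field_simp
    rw [hcoef, norm_sub_rev (x t) (x (t + 1)), norm_sub_rev (x t) xstar] at hprox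
    simp only [inner_sub_right] at hlow hup hlow' hopt
    rw [norm_sub_rev (x t) xstar, div_mul_eq_mul_div, le_div_iff₀ (by linarith)]
    linarith
end

section
/- Suppose f is (𝒞, δ)-regular for some δ > 0, and suppose there is a minimizer x* of F(x) := f(x) + h(x) over all of ℝ^d with x* ∈ 𝒞. Let x_t ∈ 𝒞 and let x_{t+1} ∈ argmin_{z ∈ 𝒞} [⟨∇f(x_t), z⟩ + ((1+δ)/2)‖x_t − z‖² + h(z)]. Then F(x_{t+1}) − F(x*) ≤ δ‖x_t − x*‖². -/
open scoped RealInnerProductSpace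

/-- One-step descent inequality for constrained proximal gradient descent:
if `f` is `(𝒞, δ)`-regular and `x*` is an unconstrained minimizer of
`F = f + h` lying in `𝒞`, then the next iterate satisfies
`F(x_{t+1}) − F(x*) ≤ δ‖x_t − x*‖²`. -/
theorem constrained_prox_grad_one_step_bound {d : ℕ}
    (C : Set (EuclideanSpace ℝ (Fin d))) (hC : IsClosed C)
    (f : EuclideanSpace ℝ (Fin d) → ℝ)
    (f' : EuclideanSpace ℝ (Fin d) → EuclideanSpace ℝ (Fin d))
    (hf : ∀ x, HasGradientAt f (f' x) x)
    (h : EuclideanSpace ℝ (Fin d) → ℝ)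
    (hconv : ConvexOn ℝ Set.univ h) (hbdd : BddBelow (Set.range h))
    (δ : ℝ) (hδ : 0 < δ)
    (hreg : ∀ x ∈ C, ∀ y ∈ C,
      |f y - f x - ⟪f' x, y - x⟫ - 1 / 2 * ‖y - x‖ ^ 2| ≤ δ / 2 * ‖y - x‖ ^ 2)
    (xstar : EuclideanSpace ℝ (Fin d)) (hxstarC : xstar ∈ C)
    (hxstar : ∀ x, f xstar + h xstar ≤ f x + h x)
    (xt xnext : EuclideanSpace ℝ (Fin d)) (hxt : xt ∈ C) (hxnext : xnext ∈ C)
    (hstep : ∀ z ∈ C,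
      ⟪f' xt, xnext⟫ + (1 + δ) / 2 * ‖xt - xnext‖ ^ 2 + h xnext ≤
        ⟪f' xt, z⟫ + (1 + δ) / 2 * ‖xt - z‖ ^ 2 + h z) :
    f xnext + h xnext - (f xstar + h xstar) ≤ δ * ‖xt - xstar‖ ^ 2 := by
  have hupper := (abs_le.mp (hreg xt hxt xnext hxnext)).2
  have hlower := (abs_le.mp (hreg xt hxt xstar hxstarC)).1
  have hmin := hstep xstar hxstarC
  rw [inner_sub_right, norm_sub_rev] at hupper hlower
  linarith
end

section
/- Suppose f is (𝒞, δ)-regular for some δ ∈ (0, 1), and suppose there is a minimizer x* of F(x) := f(x) + h(x) over all of ℝ^d with x* ∈ 𝒞. Then for every x ∈ 𝒞, F(x) − F(x*) ≥ ((1−δ)/2)·‖x − x*‖². -/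
open scoped RealInnerProductSpace

/-- First-order optimality: a global minimizer `z` of `f + h`, with `f` differentiable at `z` and
`h` convex, satisfies `h z ≤ h y + ⟪∇f z, y - z⟫` for every `y`. -/
theorem inner_gradient_add_sub_nonneg_of_forall_le {E : Type*} [NormedAddCommGroup E]
    [InnerProductSpace ℝ E] [CompleteSpace E] {f h : E → ℝ} {g z : E}
    (hf : HasGradientAt f g z) (hconv : ConvexOn ℝ Set.univ h)
    (hmin : ∀ x, f z + h z ≤ f x + h x) (y : E) :
    0 ≤ ⟪g, y - z⟫ + (h y - h z) := by
  have hderiv : HasDerivAt (fun t : ℝ => f (z + t • (y - z))) ⟪g, y - z⟫ 0 := by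
    have hline : HasDerivAt (fun t : ℝ => z + t • (y - z)) (y - z) 0 := by
      simpa using ((hasDerivAt_id (0 : ℝ)).smul_const (y - z)).const_add z
    have hz : HasFDerivAt f (InnerProductSpace.toDual ℝ E g) (z + (0 : ℝ) • (y - z)) := by
      simpa using hf.hasFDerivAt
    simpa [Function.comp_def] using hz.comp_hasDerivAt (0 : ℝ) hline
  have hlim := hderiv.tendsto_slope_zero_right
  suffices h z - h y ≤ ⟪g, y - z⟫ by linarith
  refine ge_of_tendsto hlim ?_
  filter_upwards [Ioo_mem_nhdsGT (zero_lt_one' ℝ)] with t ⟨ht0, ht1⟩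
  have hc := hconv.2 (Set.mem_univ z) (Set.mem_univ y) (sub_nonneg.2 ht1.le) ht0.le (by ring)
  have hpt : (1 - t) • z + t • y = z + t • (y - z) := by module
  rw [hpt] at hc
  have hm := hmin (z + t • (y - z))
  simp only [smul_eq_mul, zero_add, zero_smul, add_zero] at hc ⊢
  rw [le_inv_mul_iff₀ ht0]
  linarith

/-- Quadratic growth of `F = f + h` around its unconstrained minimizer `x* ∈ 𝒞`:
if `f` is `(𝒞, δ)`-regular with `δ ∈ (0, 1)`, then for every `x ∈ 𝒞`,
`F(x) − F(x*) ≥ ((1−δ)/2)‖x − x*‖²`. -/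
theorem regular_quadratic_growth {d : ℕ}
    (C : Set (EuclideanSpace ℝ (Fin d))) (hC : IsClosed C)
    (f : EuclideanSpace ℝ (Fin d) → ℝ)
    (f' : EuclideanSpace ℝ (Fin d) → EuclideanSpace ℝ (Fin d))
    (hf : ∀ x, HasGradientAt f (f' x) x)
    (h : EuclideanSpace ℝ (Fin d) → ℝ)
    (hconv : ConvexOn ℝ Set.univ h) (hbdd : BddBelow (Set.range h))
    (δ : ℝ) (hδ0 : 0 < δ) (hδ1 : δ < 1)
    (hreg : ∀ x ∈ C, ∀ y ∈ C,
      |f y - f x - ⟪f' x, y - x⟫ - 1 / 2 * ‖y - x‖ ^ 2| ≤ δ / 2 * ‖y - x‖ ^ 2)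
    (xstar : EuclideanSpace ℝ (Fin d)) (hxstarC : xstar ∈ C)
    (hxstar : ∀ x, f xstar + h xstar ≤ f x + h x) :
    ∀ x ∈ C, (1 - δ) / 2 * ‖x - xstar‖ ^ 2 ≤ f x + h x - (f xstar + h xstar) := by
  intro x hx
  have hopt := inner_gradient_add_sub_nonneg_of_forall_le (hf xstar) hconv hxstar x
  have hlower := (abs_le.1 (hreg xstar hxstarC x hx)).1
  linarith
end
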